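/- For every p ∈ ℍⁿ, the exponential map exp_p is a bijection from the tangent space T_pℍⁿ = {v ∈ ℝ^{n+1} : ⟨p,v⟩_η = 0} onto the hyperboloid ℍⁿ, with inverse log_p. -/

import Mathlib

noncomputable def mink (n : ℕ) (x y : Fin (n+1) → ℝ) : ℝ :=
  -(x 0 * y 0) + ∑ i : Fin n, x i.succ * y i.succ

def Hyp (n : ℕ) : Set (Fin (n+1) → ℝ) :=
  {x | mink n x x = -1 ∧ 0 < x 0}

noncomputable def origin (n : ℕ) : Fin (n+1) → ℝ :=
  fun i => if i = 0 then 1 else 0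

noncomputable def mnorm (n : ℕ) (v : Fin (n+1) → ℝ) : ℝ :=
  Real.sqrt (mink n v v)

noncomputable def arcosh (x : ℝ) : ℝ :=
  Real.log (x + Real.sqrt (x ^ 2 - 1))

noncomputable def dH (n : ℕ) (c : ℝ) (p q : Fin (n+1) → ℝ) : ℝ :=
  (1 / Real.sqrt |c|) * arcosh (-(mink n p q))

noncomputable def expMap (n : ℕ) (c : ℝ) (p v : Fin (n+1) → ℝ) : Fin (n+1) → ℝ :=
  if v = 0 then p
  else Real.cosh (Real.sqrt |c| * mnorm n v) • p
    + (Real.sinh (Real.sqrt |c| * mnorm n v) / mnorm n v) • v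

noncomputable def logMap (n : ℕ) (c : ℝ) (p q : Fin (n+1) → ℝ) : Fin (n+1) → ℝ :=
  if q = p then 0
  else (dH n c p q / Real.sinh (Real.sqrt |c| * dH n c p q)) •
    (q - Real.cosh (Real.sqrt |c| * dH n c p q) • p)

noncomputable def proj (n : ℕ) (v : Fin (n+1) → ℝ) : Fin n → ℝ :=
  fun i => v i.succ

noncomputable def emb (d : ℕ) (w : Fin d → ℝ) : Fin (d+1) → ℝ :=
  Fin.cons 0 w

noncomputable def FW (n d : ℕ) (c : ℝ) (W : (Fin n → ℝ) →ₗ[ℝ] (Fin d → ℝ))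
    (x : Fin (n+1) → ℝ) : Fin (d+1) → ℝ :=
  expMap d c (origin d) (emb d (W (proj n (logMap n c (origin n) x))))

lemma mink_comm (n : ℕ) (x y : Fin (n+1) → ℝ) : mink n x y = mink n y x := by
  simp only [mink, mul_comm]

lemma mink_add_right (n : ℕ) (x y z : Fin (n+1) → ℝ) :
    mink n x (y + z) = mink n x y + mink n x z := by
  simp only [mink, Pi.add_apply, mul_add, Finset.sum_add_distrib]
  ring

lemma mink_smul_right (n : ℕ) (a : ℝ) (x y : Fin (n+1) → ℝ) :
    mink n x (a • y) = a * mink n x y := by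
  simp only [mink, Pi.smul_apply, smul_eq_mul, mul_add, Finset.mul_sum]
  congr 1
  · ring
  · exact Finset.sum_congr rfl fun i _ => by ring

lemma mink_add_left (n : ℕ) (x y z : Fin (n+1) → ℝ) :
    mink n (y + z) x = mink n y x + mink n z x := by
  rw [mink_comm, mink_add_right, mink_comm n x y, mink_comm n x z]

lemma mink_smul_left (n : ℕ) (a : ℝ) (x y : Fin (n+1) → ℝ) :
    mink n (a • y) x = a * mink n y x := by
  rw [mink_comm, mink_smul_right, mink_comm]

/-- The Cauchy–Schwarz inequality for the spatial coordinates. -/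
lemma spatial_cauchy_schwarz (n : ℕ) (x y : Fin (n+1) → ℝ) :
    (mink n x y + x 0 * y 0) ^ 2 ≤ (mink n x x + x 0 ^ 2) * (mink n y y + y 0 ^ 2) := by
  have h := Finset.sum_mul_sq_le_sq_mul_sq Finset.univ
    (fun i : Fin n => x i.succ) (fun i : Fin n => y i.succ)
  simp only [mink]
  ring_nf at h ⊢
  exact h

lemma mink_self_add_sq_nonneg (n : ℕ) (x : Fin (n+1) → ℝ) : 0 ≤ mink n x x + x 0 ^ 2 := by
  have h : 0 ≤ ∑ i : Fin n, x i.succ * x i.succ :=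
    Finset.sum_nonneg fun i _ => mul_self_nonneg _
  simp only [mink]
  nlinarith

lemma mink_self_pos {n : ℕ} {p v : Fin (n+1) → ℝ} (hp : p ∈ Hyp n) (hv : mink n p v = 0)
    (hv0 : v ≠ 0) : 0 < mink n v v := by
  by_contra! hle
  obtain ⟨hpp, hp0⟩ := hp
  have hcs := spatial_cauchy_schwarz n p v
  have hnn := mink_self_add_sq_nonneg n v
  have hnp := mink_self_add_sq_nonneg n p
  rw [hv, hpp] at hcs
  rw [hpp] at hnp
  have hsq : v 0 ^ 2 ≤ 0 := by nlinarith [mul_nonneg hnp (neg_nonneg.2 hle)]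
  have hz : v 0 = 0 := by nlinarith
  have hs : ∑ i : Fin n, v i.succ * v i.succ = 0 := by
    refine le_antisymm ?_ (Finset.sum_nonneg fun i _ => mul_self_nonneg _)
    simpa [mink, hz] using hle
  rw [Finset.sum_eq_zero_iff_of_nonneg fun i _ => mul_self_nonneg _] at hs
  refine hv0 (funext fun i => ?_)
  refine Fin.cases hz (fun j => ?_) i
  exact mul_self_eq_zero.1 (hs j (Finset.mem_univ j))

lemma mink_neg_of_mem {n : ℕ} {p q : Fin (n+1) → ℝ} (hp : p ∈ Hyp n) (hq : q ∈ Hyp n) :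
    mink n p q < 0 := by
  obtain ⟨hpp, hp0⟩ := hp
  obtain ⟨hqq, hq0⟩ := hq
  have hcs := spatial_cauchy_schwarz n p q
  have hnq := mink_self_add_sq_nonneg n q
  have hnp := mink_self_add_sq_nonneg n p
  rw [hpp, hqq] at hcs
  rw [hqq] at hnq
  rw [hpp] at hnp
  by_contra! h
  have := mul_pos hp0 hq0
  nlinarith

lemma mem_Hyp_of_mink_neg {n : ℕ} {p x : Fin (n+1) → ℝ} (hp : p ∈ Hyp n)
    (hx : mink n x x = -1) (hpx : mink n p x < 0) : x ∈ Hyp n := by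
  refine ⟨hx, ?_⟩
  by_contra! hle
  have hnx := mink_self_add_sq_nonneg n x
  rw [hx] at hnx
  have hmem : (-1 : ℝ) • x ∈ Hyp n := by
    refine ⟨by rw [mink_smul_left, mink_smul_right, hx]; norm_num, ?_⟩
    simp only [Pi.smul_apply, smul_eq_mul]
    nlinarith
  have := mink_neg_of_mem hp hmem
  rw [mink_smul_right] at this
  linarith

lemma one_lt_neg_mink {n : ℕ} {p q : Fin (n+1) → ℝ} (hp : p ∈ Hyp n) (hq : q ∈ Hyp n)
    (hqp : q ≠ p) : 1 < -mink n p q := by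
  have hneg := mink_neg_of_mem hp hq
  have hu : mink n p (q + mink n p q • p) = 0 := by
    rw [mink_add_right, mink_smul_right, hp.1]; ring
  have huu : mink n (q + mink n p q • p) (q + mink n p q • p) = mink n p q ^ 2 - 1 := by
    rw [mink_add_left, mink_smul_left, hu, mink_add_right, mink_smul_right, hq.1, mink_comm n q p]
    ring
  by_cases h0 : q + mink n p q • p = 0
  · have h1 : mink n p q ^ 2 - 1 = 0 := by rw [← huu, h0]; simp [mink]
    have h2 : mink n p q = -1 := by nlinarith
    rw [h2] at h0
    exact absurd (by simpa [add_neg_eq_zero] using h0) hqp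
  · have := mink_self_pos hp hu h0
    rw [huu] at this
    nlinarith

lemma arcosh_eq_real_arcosh (x : ℝ) : arcosh x = Real.arcosh x := rfl

lemma mnorm_smul_of_nonneg {n : ℕ} {a : ℝ} (ha : 0 ≤ a) (v : Fin (n+1) → ℝ) :
    mnorm n (a • v) = a * mnorm n v := by
  rw [mnorm, mink_smul_left, mink_smul_right, ← mul_assoc, Real.sqrt_mul (mul_self_nonneg a),
    Real.sqrt_mul_self ha, mnorm]

lemma mnorm_pos {n : ℕ} {p v : Fin (n+1) → ℝ} (hp : p ∈ Hyp n) (hv : mink n p v = 0)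
    (hv0 : v ≠ 0) : 0 < mnorm n v :=
  Real.sqrt_pos.2 (mink_self_pos hp hv hv0)

lemma mink_expMap {n : ℕ} (c : ℝ) {p v : Fin (n+1) → ℝ} (hp : p ∈ Hyp n)
    (hv : mink n p v = 0) (hv0 : v ≠ 0) :
    mink n p (expMap n c p v) = -Real.cosh (√|c| * mnorm n v) := by
  rw [expMap, if_neg hv0, mink_add_right, mink_smul_right, mink_smul_right, hp.1, hv]
  ring

lemma expMap_mem_Hyp {n : ℕ} (c : ℝ) {p v : Fin (n+1) → ℝ} (hp : p ∈ Hyp n)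
    (hv : mink n p v = 0) : expMap n c p v ∈ Hyp n := by
  by_cases hv0 : v = 0
  · rwa [expMap, if_pos hv0]
  refine mem_Hyp_of_mink_neg hp ?_ ?_
  · have hm := mnorm_pos hp hv hv0
    have hsq : mnorm n v ^ 2 = mink n v v := Real.sq_sqrt (mink_self_pos hp hv hv0).le
    have hcs := Real.cosh_sq (√|c| * mnorm n v)
    rw [expMap, if_neg hv0]
    simp only [mink_add_left, mink_add_right, mink_smul_left, mink_smul_right, hp.1, hv,
      mink_comm n v p, ← hsq]
    field_simp
    linear_combination (-mnorm n v) * hcs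
  · rw [mink_expMap c hp hv hv0]
    exact neg_neg_of_pos (Real.cosh_pos _)

lemma logMap_expMap {n : ℕ} {c : ℝ} (hc : c ≠ 0) {p v : Fin (n+1) → ℝ} (hp : p ∈ Hyp n)
    (hv : mink n p v = 0) : logMap n c p (expMap n c p v) = v := by
  by_cases hv0 : v = 0
  · simp [expMap, logMap, hv0]
  have hs : 0 < √|c| := Real.sqrt_pos.2 (abs_pos.2 hc)
  have hm := mnorm_pos hp hv hv0
  have hsm := mul_pos hs hm
  have hd : dH n c p (expMap n c p v) = mnorm n v := by
    rw [dH, mink_expMap c hp hv hv0, neg_neg, arcosh_eq_real_arcosh, Real.arcosh_cosh hsm.le]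
    field_simp
  have hne : expMap n c p v ≠ p := by
    intro h
    have h1 := mink_expMap c hp hv hv0
    rw [h, hp.1] at h1
    have := Real.one_lt_cosh.2 hsm.ne'
    linarith
  have hsinh := (Real.sinh_pos_iff.2 hsm).ne'
  rw [logMap, if_neg hne, hd, expMap, if_neg hv0, add_sub_cancel_left, smul_smul,
    div_mul_div_cancel₀ hsinh, div_self hm.ne', one_smul]

lemma mink_logMap {n : ℕ} {c : ℝ} (hc : c ≠ 0) {p q : Fin (n+1) → ℝ} (hp : p ∈ Hyp n)
    (hq : q ∈ Hyp n) : mink n p (logMap n c p q) = 0 := by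
  by_cases hqp : q = p
  · simp [logMap, hqp, mink]
  have hs : 0 < √|c| := Real.sqrt_pos.2 (abs_pos.2 hc)
  have hd : √|c| * dH n c p q = Real.arcosh (-mink n p q) := by
    rw [dH, arcosh_eq_real_arcosh]; field_simp
  rw [logMap, if_neg hqp, hd, Real.cosh_arcosh (one_lt_neg_mink hp hq hqp).le, neg_smul,
    sub_neg_eq_add, mink_smul_right, mink_add_right, mink_smul_right, hp.1]
  ring

lemma expMap_logMap {n : ℕ} {c : ℝ} (hc : c ≠ 0) {p q : Fin (n+1) → ℝ} (hp : p ∈ Hyp n)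
    (hq : q ∈ Hyp n) : expMap n c p (logMap n c p q) = q := by
  by_cases hqp : q = p
  · simp [logMap, expMap, hqp]
  have hs : 0 < √|c| := Real.sqrt_pos.2 (abs_pos.2 hc)
  have ht := one_lt_neg_mink hp hq hqp
  have hd : √|c| * dH n c p q = Real.arcosh (-mink n p q) := by
    rw [dH, arcosh_eq_real_arcosh]; field_simp
  have hsd : 0 < √|c| * dH n c p q := hd ▸ Real.arcosh_pos ht
  have hd0 : 0 < dH n c p q := pos_of_mul_pos_right hsd hs.le
  have hcosh : Real.cosh (√|c| * dH n c p q) = -mink n p q := by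
    rw [hd, Real.cosh_arcosh ht.le]
  have hsinh := Real.sinh_pos_iff.2 hsd
  have hnorm : mnorm n (q - Real.cosh (√|c| * dH n c p q) • p) =
      Real.sinh (√|c| * dH n c p q) := by
    rw [mnorm, Real.sqrt_eq_iff_mul_self_eq_of_pos hsinh, ← pow_two, Real.sinh_sq, hcosh,
      neg_smul, sub_neg_eq_add]
    simp only [mink_add_left, mink_add_right, mink_smul_left, mink_smul_right, hp.1, hq.1,
      mink_comm n q p]
    ring
  have hlog : mnorm n (logMap n c p q) = dH n c p q := by
    rw [logMap, if_neg hqp, mnorm_smul_of_nonneg (div_pos hd0 hsinh).le, hnorm,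
      div_mul_cancel₀ _ hsinh.ne']
  have hne : logMap n c p q ≠ 0 := by
    intro h
    rw [h] at hlog
    simp [mnorm, mink] at hlog
    exact hd0.ne hlog
  rw [expMap, if_neg hne, hlog, logMap, if_neg hqp, smul_smul, div_mul_div_cancel₀ hd0.ne',
    div_self hsinh.ne', one_smul, add_sub_cancel]

theorem stmt_8 (n : ℕ) (hn : 1 ≤ n) (c : ℝ) (hc : c < 0)
    (p : Fin (n+1) → ℝ) (hp : p ∈ Hyp n) :
    Set.BijOn (expMap n c p) {v : Fin (n+1) → ℝ | mink n p v = 0} (Hyp n) ∧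
    (∀ v : Fin (n+1) → ℝ, mink n p v = 0 → logMap n c p (expMap n c p v) = v) ∧
    (∀ q ∈ Hyp n, expMap n c p (logMap n c p q) = q) := by
  have hl : ∀ v : Fin (n+1) → ℝ, mink n p v = 0 → logMap n c p (expMap n c p v) = v :=
    fun v hv => logMap_expMap hc.ne hp hv
  have hr : ∀ q ∈ Hyp n, expMap n c p (logMap n c p q) = q :=
    fun q hq => expMap_logMap hc.ne hp hq
  exact ⟨Set.InvOn.bijOn ⟨hl, hr⟩ (fun v hv => expMap_mem_Hyp c hp hv)
    (fun q hq => mink_logMap hc.ne hp hq), hl, hr⟩
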